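/- For every integer n ≥ 2, the set of positive n-th roots of the full twist in the braid group B_n — that is, the set of positive braids β ∈ B_n satisfying β^n = Δ_n² — has exactly 2^{n−2} elements, and every element of this set is conjugate in B_n to the standard root δ_n = σ_1 σ_2 ⋯ σ_{n−1}. -/

import Mathlib

/-- The braid relations on `m` generators (for the braid group `B_{m+1}`). -/
def braidRels (m : ℕ) : Set (FreeGroup (Fin m)) :=
  { r | (∃ i j : Fin m, (i : ℕ) + 2 ≤ (j : ℕ) ∧
      r = FreeGroup.of i * FreeGroup.of j * (FreeGroup.of i)⁻¹ * (FreeGroup.of j)⁻¹) ∨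
    (∃ i j : Fin m, (j : ℕ) = (i : ℕ) + 1 ∧
      r = FreeGroup.of i * FreeGroup.of j * FreeGroup.of i *
          (FreeGroup.of j * FreeGroup.of i * FreeGroup.of j)⁻¹) }

/-- The braid group `B_n`, presented on `n - 1` generators. -/
abbrev BraidGroup (n : ℕ) := PresentedGroup (braidRels (n - 1))

/-- The generator `σ_i` of `B_n`, for `1 ≤ i ≤ n - 1` (and the identity otherwise). -/
def braidGen (n i : ℕ) : BraidGroup n :=
  if h : 1 ≤ i ∧ i ≤ n - 1 then PresentedGroup.of (⟨i - 1, by omega⟩ : Fin (n - 1)) else 1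

/-- The product `σ_{i_1} σ_{i_2} ⋯ σ_{i_ℓ}` associated to a list of indices. -/
def wordProd (n : ℕ) (l : List ℕ) : BraidGroup n := (l.map (braidGen n)).prod

/-- A positive braid: a product of generators `σ_i`, `1 ≤ i ≤ n-1` (no inverses). -/
def IsPositiveBraid (n : ℕ) (β : BraidGroup n) : Prop :=
  ∃ l : List ℕ, (∀ i ∈ l, 1 ≤ i ∧ i ≤ n - 1) ∧ β = wordProd n l

/-- The half twist `Δ_n = (σ_1)(σ_2 σ_1)(σ_3 σ_2 σ_1) ⋯ (σ_{n-1} ⋯ σ_1)`. -/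
def halfTwist (n : ℕ) : BraidGroup n :=
  wordProd n (((List.range (n - 1)).map (fun k => (List.range (k + 1)).reverse.map (· + 1))).flatten)

/-- The standard root `δ_n = σ_1 σ_2 ⋯ σ_{n-1}`. -/
def stdRoot (n : ℕ) : BraidGroup n := wordProd n ((List.range (n - 1)).map (· + 1))

/-- The reversed root `δ̄_n = σ_{n-1} σ_{n-2} ⋯ σ_1`. -/
def stdRootBar (n : ℕ) : BraidGroup n := wordProd n (((List.range (n - 1)).map (· + 1)).reverse)

/-- The descending chain `b, b-1, …, a+1` (of length `b - a`). -/
def chainDesc (a b : ℕ) : List ℕ := (List.range (b - a)).map (fun t => b - t)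

/-- The normal-form index sequence of a subset `S = {j_1 < ⋯ < j_r} ⊆ {1, …, n-2}`:
the concatenation of the decreasing chains
`j_1, …, 1; j_2, …, j_1 + 1; …; n-1, …, j_r + 1`. -/
def normalWord (n : ℕ) (S : Finset ℕ) : List ℕ :=
  let bs : List ℕ := (0 :: S.sort (· ≤ ·)) ++ [n - 1]
  ((bs.zip bs.tail).map (fun p => chainDesc p.1 p.2)).flatten

/-- The normal-form braid of a subset `S ⊆ {1, …, n-2}`. -/
def normalBraid (n : ℕ) (S : Finset ℕ) : BraidGroup n := wordProd n (normalWord n S)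

namespace BR

section alg
variable {G : Type*} [Group G]

def del (s : ℕ → G) : ℕ → G
  | 0 => 1
  | m + 1 => del s m * s m

def dsc (s : ℕ → G) : ℕ → G
  | 0 => 1
  | m + 1 => s m * dsc s m

def dlt (s : ℕ → G) : ℕ → G
  | 0 => 1
  | m + 1 => dlt s m * dsc s (m + 1)

def seg (s : ℕ → G) : ℕ → ℕ → G
  | _, 0 => 1
  | m, k + 1 => s m * seg s (m - 1) k

def cox (s : ℕ → G) : List Bool → G
  | [] => s 0
  | b :: t => if b then cox s t * s (t.length + 1) else s (t.length + 1) * cox s t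

variable (s : ℕ → G)

lemma comm_del (x : G) (m : ℕ) (h : ∀ j < m, Commute x (s j)) : Commute x (del s m) := by
  induction m with
  | zero => exact Commute.one_right x
  | succ m ih => exact (ih fun j hj => h j (by omega)).mul_right (h m (by omega))

lemma comm_dsc (x : G) (m : ℕ) (h : ∀ j < m, Commute x (s j)) : Commute x (dsc s m) := by
  induction m with
  | zero => exact Commute.one_right x
  | succ m ih => exact (h m (by omega)).mul_right (ih fun j hj => h j (by omega))

lemma comm_dlt (x : G) (m : ℕ) (h : ∀ j < m, Commute x (s j)) : Commute x (dlt s m) := by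
  induction m with
  | zero => exact Commute.one_right x
  | succ m ih => exact (ih fun j hj => h j (by omega)).mul_right (comm_dsc s x _ h)

lemma comm_cox (x : G) (t : List Bool) (h : ∀ j < t.length + 1, Commute x (s j)) :
    Commute x (cox s t) := by
  induction t with
  | nil => exact h 0 (by simp)
  | cons b t ih =>
    have h1 := ih fun j hj => h j (by simp; omega)
    have h2 := h (t.length + 1) (by simp)
    unfold cox
    split_ifs
    · exact h1.mul_right h2
    · exact h2.mul_right h1

lemma comm_list (x : G) (l : List ℕ) (h : ∀ j ∈ l, Commute x (s j)) :
    Commute x (l.map s).prod := by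
  induction l with
  | nil => exact Commute.one_right x
  | cons a l ih =>
    simp only [List.map_cons, List.prod_cons]
    exact (h a (by simp)).mul_right (ih fun j hj => h j (by simp [hj]))

lemma dlt_succ
    (hc : ∀ i j, i + 2 ≤ j → Commute (s i) (s j))
    (m : ℕ) : dlt s (m + 1) = del s (m + 1) * dlt s m := by
  induction m with
  | zero => simp [dlt, del, dsc]
  | succ m ih =>
    have h : Commute (s (m + 1)) (dlt s m) := comm_dlt s _ _ fun j hj => (hc j _ (by omega)).symm
    calc dlt s (m + 2) = dlt s (m + 1) * (s (m + 1) * dsc s (m + 1)) := rfl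
      _ = del s (m + 1) * (dlt s m * s (m + 1)) * dsc s (m + 1) := by rw [ih]; group
      _ = (del s (m + 1) * s (m + 1)) * (dlt s m * dsc s (m + 1)) := by rw [← h.eq]; group
      _ = _ := rfl

lemma del_s
    (hc : ∀ i j, i + 2 ≤ j → Commute (s i) (s j))
    (N : ℕ) (hb : ∀ i, i + 1 < N → s i * s (i + 1) * s i = s (i + 1) * s i * s (i + 1))
    (m i : ℕ) (hm : m ≤ N) (hi : i + 1 < m) : del s m * s i = s (i + 1) * del s m := by
  induction m with
  | zero => omega
  | succ m ih =>
    by_cases h : i + 1 < m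
    · calc del s m * s m * s i = del s m * (s i * s m) := by rw [(hc i m (by omega)).eq]; group
        _ = s (i + 1) * del s m * s m := by rw [← mul_assoc, ih (by omega) h]
        _ = _ := by rw [mul_assoc]; rfl
    · obtain rfl : m = i + 1 := by omega
      have h1 : Commute (s (i + 1)) (del s i) :=
        comm_del s _ _ fun j hj => (hc j _ (by omega)).symm
      calc del s i * s i * s (i + 1) * s i = del s i * (s i * s (i + 1) * s i) := by group
        _ = del s i * s (i + 1) * (s i * s (i + 1)) := by rw [hb i (by omega)]; group
        _ = s (i + 1) * (del s i * s i * s (i + 1)) := by rw [← h1.eq]; group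

lemma dsc_s
    (hc : ∀ i j, i + 2 ≤ j → Commute (s i) (s j))
    (N : ℕ) (hb : ∀ i, i + 1 < N → s i * s (i + 1) * s i = s (i + 1) * s i * s (i + 1))
    (m i : ℕ) (hm : m ≤ N) (hi : i + 1 < m) : dsc s m * s (i + 1) = s i * dsc s m := by
  induction m with
  | zero => omega
  | succ m ih =>
    by_cases h : i + 1 < m
    · calc s m * dsc s m * s (i + 1) = s m * s i * dsc s m := by
            rw [mul_assoc, ih (by omega) h, mul_assoc]
        _ = s i * (s m * dsc s m) := by rw [← (hc i m (by omega)).eq, mul_assoc]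
    · obtain rfl : m = i + 1 := by omega
      have h1 : Commute (s (i + 1)) (dsc s i) :=
        comm_dsc s _ _ fun j hj => (hc j _ (by omega)).symm
      calc s (i + 1) * (s i * dsc s i) * s (i + 1)
          = s (i + 1) * s i * (dsc s i * s (i + 1)) := by group
        _ = s (i + 1) * s i * s (i + 1) * dsc s i := by rw [← h1.eq]; group
        _ = s i * (s (i + 1) * (s i * dsc s i)) := by rw [← hb i (by omega)]; group

lemma seg_del
    (hc : ∀ i j, i + 2 ≤ j → Commute (s i) (s j))
    (N : ℕ) (hb : ∀ i, i + 1 < N → s i * s (i + 1) * s i = s (i + 1) * s i * s (i + 1))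
    (M k m : ℕ) (hM : M + 1 ≤ N) (hk : k ≤ m) (hm : m ≤ M) :
    seg s m k * del s (M + 1) = del s (M + 1) * seg s (m - 1) k := by
  induction k generalizing m with
  | zero => simp [seg]
  | succ k ih =>
    obtain ⟨p, rfl⟩ : ∃ p, m = p + 1 := ⟨m - 1, by omega⟩
    have h := ih p (by omega) (by omega)
    calc s (p + 1) * seg s p k * del s (M + 1)
        = s (p + 1) * del s (M + 1) * seg s (p - 1) k := by rw [mul_assoc, h, mul_assoc]
      _ = del s (M + 1) * (s p * seg s (p - 1) k) := by
          rw [← del_s s hc N hb (M + 1) p hM (by omega), mul_assoc]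

lemma seg_full (m : ℕ) : seg s m (m + 1) = dsc s (m + 1) := by
  induction m with
  | zero => rfl
  | succ m ih =>
    calc seg s (m + 1) (m + 2) = s (m + 1) * seg s m (m + 1) := rfl
      _ = _ := by rw [ih]; rfl

lemma del_pow
    (hc : ∀ i j, i + 2 ≤ j → Commute (s i) (s j))
    (N : ℕ) (hb : ∀ i, i + 1 < N → s i * s (i + 1) * s i = s (i + 1) * s i * s (i + 1))
    (m k : ℕ) (hm : m + 1 ≤ N) (hk : k ≤ m + 1) :
    del s (m + 1) ^ k = del s m ^ k * seg s m k := by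
  induction k with
  | zero => simp [seg]
  | succ k ih =>
    rw [pow_succ, ih (by omega), mul_assoc, seg_del s hc N hb m k m hm (by omega) le_rfl, pow_succ]
    simp only [del, seg, mul_assoc]

lemma full_twist
    (hc : ∀ i j, i + 2 ≤ j → Commute (s i) (s j))
    (N : ℕ) (hb : ∀ i, i + 1 < N → s i * s (i + 1) * s i = s (i + 1) * s i * s (i + 1))
    (m : ℕ) (hm : m ≤ N) : dlt s m ^ 2 = del s m ^ (m + 1) ∧
    ∀ i < m, Commute (dlt s m ^ 2) (s i) := by
  induction m with
  | zero => simp [dlt, del]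
  | succ m ih =>
    obtain ⟨h1, h2⟩ := ih (by omega)
    have hDi : ∀ i < m, Commute (dsc s (m + 1) * del s (m + 1)) (s i) := by
      intro i hi
      show _ * _ = _ * _
      rw [mul_assoc, del_s s hc N hb (m + 1) i hm (by omega), ← mul_assoc,
        dsc_s s hc N hb (m + 1) i hm (by omega), mul_assoc]
    have hD := comm_dlt s _ _ hDi
    have e1 : dlt s (m + 1) ^ 2 = dlt s m ^ 2 * (dsc s (m + 1) * del s (m + 1)) := by
      calc dlt s (m + 1) ^ 2 = (dlt s m * dsc s (m + 1)) * dlt s (m + 1) := pow_two _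
        _ = dlt s m * ((dsc s (m + 1) * del s (m + 1)) * dlt s m) := by
          rw [dlt_succ s hc]; group
        _ = _ := by rw [hD.eq, pow_two]; group
    have e2 : dlt s (m + 1) ^ 2 = del s (m + 1) ^ (m + 1 + 1) := by
      rw [e1, h1, pow_succ (del s (m + 1)), del_pow s hc N hb m (m + 1) hm le_rfl, seg_full,
        mul_assoc]
    have h3 : ∀ i < m, Commute (dlt s (m + 1) ^ 2) (s i) := by
      intro i hi
      rw [e1]
      exact (h2 i hi).mul_left (hDi i hi)
    refine ⟨e2, fun i hi => ?_⟩
    by_cases h : i < m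
    · exact h3 i h
    obtain rfl : i = m := by omega
    have h4 := comm_del s _ _ h3
    have h5 : Commute (dlt s (i + 1) ^ 2) (del s (i + 1)) := by
      rw [e2]; exact (Commute.refl _).pow_left _
    have e : s i = (del s i)⁻¹ * del s (i + 1) := by simp [del]
    rw [e]
    exact h4.inv_right.mul_right h5

lemma cox_conj (t : List Bool) (w : G) (h : ∀ j < t.length, Commute w (s j)) 
    (hc : ∀ i j, i + 2 ≤ j → Commute (s i) (s j)) :
    IsConj (del s (t.length + 1) * w) (cox s t * w) := by
  induction t generalizing w with
  | nil => simp only [cox, del, List.length_nil, one_mul]; exact IsConj.refl _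
  | cons b t ih =>
    have h1 := ih (s (t.length + 1) * w) (fun j hj =>
      ((hc j _ (by omega)).symm).mul_left (h j (by simp; omega)))
    have e : del s ((b :: t).length + 1) * w = del s (t.length + 1) * (s (t.length + 1) * w) := by
      simp [del, mul_assoc]
    rw [e]
    unfold cox
    split_ifs
    · rwa [mul_assoc]
    · refine h1.trans ?_
      have h2 : Commute w (cox s t) := comm_cox s _ _ fun j hj => h j (by simpa using hj)
      rw [mul_assoc, ← h2.eq, isConj_iff]
      exact ⟨(cox s t)⁻¹, by group⟩

lemma word_cox (hc : ∀ i j, i + 2 ≤ j → Commute (s i) (s j)) (m : ℕ) (l : List ℕ)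
    (hl : l.Perm (List.range (m + 1))) :
    ∃ t : List Bool, t.length = m ∧ (l.map s).prod = cox s t := by
  induction m generalizing l with
  | zero =>
    refine ⟨[], rfl, ?_⟩
    have : l = [0] := by simpa using hl
    simp [this, cox]
  | succ m ih =>
    have hmem : m + 1 ∈ l := hl.mem_iff.2 (by simp)
    have hnd : l.Nodup := hl.nodup_iff.2 List.nodup_range
    obtain ⟨u, v, rfl⟩ := List.append_of_mem hmem
    have hp : (u ++ v).Perm (List.range (m + 1)) := by
      have h1 : ((m + 1) :: (u ++ v)).Perm ((m + 1) :: List.range (m + 1)) := by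
        refine List.perm_middle.symm.trans (hl.trans ?_)
        rw [List.range_succ]
        exact List.perm_append_singleton _ _
      exact h1.cons_inv
    obtain ⟨t, ht, he⟩ := ih _ hp
    have hm : m ∈ u ++ v := hp.mem_iff.2 (by simp)
    have hnd2 : (u ++ v).Nodup := hp.nodup_iff.2 List.nodup_range
    have hlt2 : ∀ j ∈ u ++ v, j < m + 1 := fun j hj => by simpa using hp.mem_iff.1 hj
    simp only [List.map_append, List.prod_append] at he
    have hdisj := List.disjoint_of_nodup_append hnd2
    rcases List.mem_append.1 hm with hu | hv
    · refine ⟨true :: t, by simp [ht], ?_⟩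
      have hcm : Commute (s (m + 1)) (v.map s).prod := by
        refine comm_list s _ _ fun j hj => (hc j _ ?_).symm
        have := hlt2 j (by simp [hj])
        have : j ≠ m := by rintro rfl; exact hdisj hu hj
        omega
      simp only [cox, ht, if_true, List.map_append, List.prod_append, List.map_cons,
        List.prod_cons]
      rw [hcm.eq, ← he, mul_assoc]
    · refine ⟨false :: t, by simp [ht], ?_⟩
      have hcm : Commute (s (m + 1)) (u.map s).prod := by
        refine comm_list s _ _ fun j hj => (hc j _ ?_).symm
        have := hlt2 j (by simp [hj])
        have : j ≠ m := by rintro rfl; exact hdisj hj hv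
        omega
      simp only [cox, ht, List.map_append, List.prod_append, List.map_cons,
        List.prod_cons]
      rw [← mul_assoc, ← hcm.eq, ← he]
      simp [mul_assoc]

lemma cox_word (t : List Bool) : ∃ l : List ℕ, (∀ j ∈ l, j < t.length + 1) ∧
    cox s t = (l.map s).prod := by
  induction t with
  | nil => exact ⟨[0], by simp, by simp [cox]⟩
  | cons b t ih =>
    obtain ⟨l, h1, h2⟩ := ih
    cases b
    · refine ⟨(t.length + 1) :: l, ?_, by simp [cox, h2]⟩
      intro j hj
      rcases List.mem_cons.1 hj with rfl | hj
      · simp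
      · have := h1 j hj; simp; omega
    · refine ⟨l ++ [t.length + 1], ?_, by simp [cox, h2]⟩
      intro j hj
      rcases List.mem_append.1 hj with hj | hj
      · have := h1 j hj; simp; omega
      · simp at hj; simp [hj]

end alg

lemma map_del {G H : Type*} [Group G] [Group H] (f : G →* H) (s : ℕ → G) (s' : ℕ → H) (m : ℕ)
    (h : ∀ j < m, f (s j) = s' j) : f (del s m) = del s' m := by
  induction m with
  | zero => simp [del]
  | succ m ih => simp [del, ih fun j hj => h j (by omega), h m (by omega)]

lemma map_cox {G H : Type*} [Group G] [Group H] (f : G →* H) (s : ℕ → G) (s' : ℕ → H)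
    (t : List Bool) (h : ∀ j < t.length + 1, f (s j) = s' j) : f (cox s t) = cox s' t := by
  induction t with
  | nil => simp [cox, h]
  | cons b t ih =>
    have h1 := ih fun j hj => h j (by simp; omega)
    have h2 := h (t.length + 1) (by simp)
    cases b <;> simp [cox, h1, h2]

/-! permutation representation -/

def sw (j : ℕ) : Equiv.Perm ℕ := Equiv.swap j (j + 1)

lemma sw_apply (j a : ℕ) : sw j a = if a = j then j + 1 else if a = j + 1 then j else a :=
  Equiv.swap_apply_def _ _ _

lemma cox_sw_fix (t : List Bool) (a : ℕ) (ha : t.length + 1 < a) : cox sw t a = a := by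
  induction t with
  | nil => simp at ha; simp only [cox, sw_apply]; split_ifs <;> omega
  | cons b t ih =>
    simp at ha
    have h := ih (by omega)
    have h2 : sw (t.length + 1) a = a := by rw [sw_apply]; split_ifs <;> omega
    cases b <;> simp [cox, h, h2]

lemma cox_sw_le (t : List Bool) (a : ℕ) (ha : a ≤ t.length + 1) :
    cox sw t a ≤ t.length + 1 := by
  by_contra hcon
  push Not at hcon
  have h := cox_sw_fix t _ hcon
  have := (cox sw t).injective h
  omega

lemma cox_sw_lt (t : List Bool) : cox sw t (t.length + 1) < t.length + 1 := by
  cases t with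
  | nil => simp [cox, sw_apply]
  | cons b t =>
    have h1 : sw (t.length + 1) (t.length + 2) = t.length + 1 := by simp [sw_apply]
    have h2 := cox_sw_fix t (t.length + 2) (by omega)
    have h3 := cox_sw_le t (t.length + 1) le_rfl
    cases b
    · simp [cox, h1, h2]
    · simp [cox, h1]; omega

lemma cox_sw_inj (t t' : List Bool) (hl : t.length = t'.length) (h : cox sw t = cox sw t') :
    t = t' := by
  induction t generalizing t' with
  | nil => exact (List.length_eq_zero_iff.1 hl.symm).symm
  | cons b t ih =>
    cases t' with
    | nil => simp at hl
    | cons b' t' =>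
      have hl' : t.length = t'.length := by simpa using hl
      have h1 : sw (t.length + 1) (t.length + 2) = t.length + 1 := by simp [sw_apply]
      have h2 := cox_sw_fix t (t.length + 2) (by omega)
      have h2' := cox_sw_fix t' (t.length + 2) (by omega)
      have h3 := cox_sw_lt t
      have h3' := cox_sw_lt t'
      rw [← hl'] at h3'
      have h4 := congrArg (fun e => e (t.length + 2)) h
      cases b <;> cases b'
      · simp only [cox, hl'] at h
        rw [ih t' hl' (by simpa using h)]
      · simp [cox, ← hl', h1, h2] at h4; omega
      · simp [cox, ← hl', h1, h2'] at h4; omega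
      · simp only [cox, hl'] at h
        rw [ih t' hl' (by simpa using h)]

lemma sw_comm (i j : ℕ) (h : i + 2 ≤ j) : sw i * sw j = sw j * sw i := by
  ext a
  simp only [Equiv.Perm.mul_apply, sw_apply]
  grind

lemma sw_braid (i : ℕ) : sw i * sw (i + 1) * sw i = sw (i + 1) * sw i * sw (i + 1) := by
  ext a
  simp only [Equiv.Perm.mul_apply, sw_apply]
  grind

/-! linking number representation -/

def cr (j a b : ℕ) : ℤ := if (a = j ∧ b = j + 1) ∨ (a = j + 1 ∧ b = j) then 1 else 0

lemma cr_nonneg (j a b : ℕ) : 0 ≤ cr j a b := by unfold cr; split_ifs <;> simp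

lemma cr_sw (j a b : ℕ) : cr j (sw j a) (sw j b) = cr j a b := by
  simp only [cr, sw_apply]; grind

lemma sw_sw (j a : ℕ) : sw j (sw j a) = a := by simp [sw]

def lk (j : ℕ) : Equiv.Perm (ℕ × ℕ × ℤ) where
  toFun x := (sw j x.1, sw j x.2.1, x.2.2 + cr j x.1 x.2.1)
  invFun x := (sw j x.1, sw j x.2.1, x.2.2 - cr j x.1 x.2.1)
  left_inv x := by simp [cr_sw, sw_sw]
  right_inv x := by simp [cr_sw, sw_sw]

lemma lk_apply (j a b : ℕ) (k : ℤ) : lk j (a, b, k) = (sw j a, sw j b, k + cr j a b) := rfl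

lemma lk_comm (i j : ℕ) (h : i + 2 ≤ j) : lk i * lk j = lk j * lk i := by
  apply Equiv.ext
  rintro ⟨a, b, k⟩
  have h1 := fun a => congrArg (fun e => e a) (sw_comm i j h)
  simp only [Equiv.Perm.mul_apply] at h1
  simp only [Equiv.Perm.mul_apply, lk_apply, h1, Prod.mk.injEq, true_and]
  simp only [cr, sw_apply]
  grind (splits := 40)

lemma lk_braid (i : ℕ) : lk i * lk (i + 1) * lk i = lk (i + 1) * lk i * lk (i + 1) := by
  apply Equiv.ext
  rintro ⟨a, b, k⟩
  have h1 := fun a => congrArg (fun e => e a) (sw_braid i)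
  simp only [Equiv.Perm.mul_apply] at h1
  simp only [Equiv.Perm.mul_apply, lk_apply, h1, Prod.mk.injEq, true_and]
  have hcase : ∀ a : ℕ, a = i ∨ a = i + 1 ∨ a = i + 2 ∨ (a ≠ i ∧ a ≠ i + 1 ∧ a ≠ i + 2) := by
    intro a; omega
  have e1 : ¬ i = i + 1 + 1 := by omega
  have e2 : ¬ i + 1 + 1 = i := by omega
  simp only [cr, sw_apply]
  rcases hcase a with h0 | h0 | h0 | ⟨h1, h2, h3⟩ <;>
    rcases hcase b with h | h | h | ⟨h4, h5, h6⟩ <;>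
    simp [*]

lemma lk_del (m : ℕ) : del lk (m + 1) (0, m + 1, 0) = (1, 0, 1) := by
  induction m with
  | zero => simp [del, lk_apply, sw_apply, cr]
  | succ m ih =>
    have : lk (m + 1) (0, m + 2, 0) = (0, m + 1, 0) := by simp [lk_apply, sw_apply, cr]
    show del lk (m + 1) (lk (m + 1) (0, m + 2, 0)) = _
    rw [this, ih]

lemma lk_del_mono (m : ℕ) (x : ℕ × ℕ × ℤ) : x.2.2 ≤ (del lk m x).2.2 := by
  induction m generalizing x with
  | zero => simp [del]
  | succ m ih =>
    refine le_trans ?_ (ih (lk m x))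
    obtain ⟨a, b, k⟩ := x
    have := cr_nonneg m a b
    simp [lk_apply, this]

lemma lk_del_pow_mono (m p : ℕ) (x : ℕ × ℕ × ℤ) : x.2.2 ≤ ((del lk m ^ p) x).2.2 := by
  induction p generalizing x with
  | zero => simp
  | succ p ih =>
    rw [pow_succ]
    exact (lk_del_mono m x).trans (ih _)

/-- pairs separated by position `i`, with zero linking -/
def Sep (i : ℕ) (x : ℕ × ℕ × ℤ) : Prop := x.1 ≤ i ∧ i < x.2.1 ∧ x.2.2 = 0

lemma sep_lk (i j : ℕ) (h : j ≠ i) (x) (hx : Sep i x) : Sep i (lk j x) := by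
  obtain ⟨a, b, k⟩ := x
  simp only [Sep, lk_apply, sw_apply, cr] at *
  grind

lemma sep_word (i : ℕ) (l : List ℕ) (h : i ∉ l) (x) (hx : Sep i x) :
    Sep i ((l.map lk).prod x) := by
  induction l with
  | nil => simpa
  | cons a l ih =>
    simp only [List.mem_cons, not_or] at h
    simpa using sep_lk i a (Ne.symm h.1) _ (ih h.2)

lemma sep_pow (i p : ℕ) (f : Equiv.Perm (ℕ × ℕ × ℤ)) (hf : ∀ x, Sep i x → Sep i (f x)) (x)
    (hx : Sep i x) : Sep i ((f ^ p) x) := by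
  induction p generalizing x with
  | zero => simpa
  | succ p ih => rw [pow_succ]; exact ih _ (hf x hx)

lemma mem_of_pow (m i : ℕ) (hi : i < m) (l : List ℕ)
    (h : (l.map lk).prod ^ (m + 1) = del lk m ^ (m + 1)) : i ∈ l := by
  by_contra hcon
  obtain ⟨q, rfl⟩ : ∃ q, m = q + 1 := ⟨m - 1, by omega⟩
  have h1 : Sep i (0, q + 1, 0) := ⟨by simp, by simpa using hi, rfl⟩
  have h2 := sep_pow i (q + 1 + 1) _ (fun x hx => sep_word i l hcon x hx) _ h1
  rw [h, pow_succ, Equiv.Perm.mul_apply, lk_del] at h2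
  have h3 := lk_del_pow_mono (q + 1) (q + 1) (1, 0, 1)
  have h4 := h2.2.2
  simp only at h3
  omega

/-! Link with the presented group -/

def gs (n j : ℕ) : BraidGroup n := braidGen n (j + 1)

lemma gs_of (n : ℕ) (j : Fin (n - 1)) : gs n j = PresentedGroup.of j := by
  unfold gs braidGen
  rw [dif_pos ⟨by omega, by omega⟩]
  rfl

lemma gs_comm (n i j : ℕ) (h : i + 2 ≤ j) : Commute (gs n i) (gs n j) := by
  by_cases hj : j < n - 1
  · have e1 := gs_of n ⟨i, by omega⟩
    have e2 := gs_of n ⟨j, hj⟩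
    simp only at e1 e2
    rw [e1, e2]
    have hr := PresentedGroup.one_of_mem (rels := braidRels (n - 1))
      (Or.inl ⟨⟨i, by omega⟩, ⟨j, hj⟩, h, rfl⟩)
    simp only [map_mul, map_inv] at hr
    exact mul_inv_eq_iff_eq_mul.1 (mul_inv_eq_one.1 hr)
  · have : gs n j = 1 := by
      unfold gs braidGen
      rw [dif_neg (by omega)]
    rw [this]
    exact Commute.one_right _

lemma gs_braid (n i : ℕ) (h : i + 1 < n - 1) :
    gs n i * gs n (i + 1) * gs n i = gs n (i + 1) * gs n i * gs n (i + 1) := by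
  have e1 := gs_of n ⟨i, by omega⟩
  have e2 := gs_of n ⟨i + 1, h⟩
  simp only at e1 e2
  rw [e1, e2]
  have hr := PresentedGroup.one_of_mem (rels := braidRels (n - 1))
    (Or.inr ⟨⟨i, by omega⟩, ⟨i + 1, h⟩, rfl, rfl⟩)
  simp only [map_mul, map_inv] at hr
  exact mul_inv_eq_one.1 hr

lemma exists_lift {H : Type*} [Group H] (n : ℕ) (f : ℕ → H)
    (hc : ∀ i j, i + 2 ≤ j → f i * f j = f j * f i)
    (hb : ∀ i, f i * f (i + 1) * f i = f (i + 1) * f i * f (i + 1)) :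
    ∃ φ : BraidGroup n →* H, ∀ j < n - 1, φ (gs n j) = f j := by
  have hr : ∀ r ∈ braidRels (n - 1), FreeGroup.lift (fun j : Fin (n - 1) => f j) r = 1 := by
    rintro r (⟨i, j, hij, rfl⟩ | ⟨i, j, hij, rfl⟩)
    · simp only [map_mul, map_inv, FreeGroup.lift_apply_of]
      rw [hc i j hij]
      group
    · simp only [map_mul, map_inv, FreeGroup.lift_apply_of]
      rw [hij, hb i]
      group
  refine ⟨PresentedGroup.toGroup hr, fun j hj => ?_⟩
  rw [gs_of n ⟨j, hj⟩]
  exact PresentedGroup.toGroup.of hr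

lemma wordProd_succ (n : ℕ) (l : List ℕ) : wordProd n (l.map (· + 1)) = (l.map (gs n)).prod := by
  unfold wordProd
  rw [List.map_map]
  rfl

lemma stdRoot_eq (n : ℕ) : stdRoot n = del (gs n) (n - 1) := by
  unfold stdRoot
  rw [wordProd_succ]
  suffices h : ∀ p, ((List.range p).map (gs n)).prod = del (gs n) p from h _
  intro p
  induction p with
  | zero => rfl
  | succ m ih => rw [List.range_succ, List.map_append, List.prod_append, ih]; simp [del]

lemma dsc_eq {G : Type*} [Group G] (s : ℕ → G) (m : ℕ) :
    ((List.range m).reverse.map s).prod = dsc s m := by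
  induction m with
  | zero => rfl
  | succ m ih => rw [List.range_succ, List.reverse_append]; simp only [List.map_append, List.prod_append, ih]; simp [dsc]

lemma halfTwist_eq (n : ℕ) : halfTwist n = dlt (gs n) (n - 1) := by
  unfold halfTwist
  suffices h : ∀ p, wordProd n (((List.range p).map
      (fun k => (List.range (k + 1)).reverse.map (· + 1))).flatten) = dlt (gs n) p from h _
  intro p
  induction p with
  | zero => rfl
  | succ m ih =>
    rw [List.range_succ, List.map_append, List.flatten_append]
    have h : ∀ l l', wordProd n (l ++ l') = wordProd n l * wordProd n l' := by
      intro l l'; simp [wordProd]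
    rw [h, ih]
    simp only [List.map_cons, List.map_nil, List.flatten_cons, List.flatten_nil, List.append_nil]
    rw [wordProd_succ, dsc_eq]
    rfl

lemma prod_map_congr {G H : Type*} [Group G] [Group H] (f : G →* H) (s : ℕ → G) (s' : ℕ → H)
    (l : List ℕ) (h : ∀ j ∈ l, f (s j) = s' j) : f (l.map s).prod = (l.map s').prod := by
  rw [map_list_prod, List.map_map]
  congr 1
  exact List.map_congr_left h

lemma positive_iff (n : ℕ) (β : BraidGroup n) : IsPositiveBraid n β ↔
    ∃ l : List ℕ, (∀ j ∈ l, j < n - 1) ∧ β = (l.map (gs n)).prod := by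
  constructor
  · rintro ⟨l, h1, h2⟩
    refine ⟨l.map (· - 1), ?_, ?_⟩
    · intro j hj
      obtain ⟨i, hi, rfl⟩ := List.mem_map.1 hj
      have := h1 i hi
      omega
    · rw [h2, ← wordProd_succ, List.map_map]
      congr 1
      conv_lhs => rw [← List.map_id l]
      apply List.map_congr_left
      intro i hi
      have := h1 i hi
      simp only [id, Function.comp]
      omega
  · rintro ⟨l, h1, h2⟩
    refine ⟨l.map (· + 1), ?_, by rw [wordProd_succ, h2]⟩
    intro j hj
    obtain ⟨i, hi, rfl⟩ := List.mem_map.1 hj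
    have := h1 i hi
    omega

lemma root_cox (m : ℕ) (l : List ℕ) (hl : ∀ j ∈ l, j < m + 1)
    (h : (l.map (gs (m + 2))).prod ^ (m + 2) = del (gs (m + 2)) (m + 1) ^ (m + 2)) :
    ∃ t : List Bool, t.length = m ∧ (l.map (gs (m + 2))).prod = cox (gs (m + 2)) t := by
  apply word_cox _ (gs_comm (m + 2))
  have hmem : ∀ i < m + 1, i ∈ l := by
    intro i hi
    obtain ⟨φ, hφ⟩ := exists_lift (m + 2) lk lk_comm lk_braid
    apply mem_of_pow (m + 1) i hi
    have := congrArg φ h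
    rw [map_pow, map_pow, map_del φ _ lk (m + 1) (fun j hj => hφ j hj),
      prod_map_congr φ _ lk _ (fun j hj => hφ j (hl j hj))] at this
    exact this
  have hlen : l.length = m + 1 := by
    obtain ⟨φ, hφ⟩ := exists_lift (m + 2) (fun _ => Multiplicative.ofAdd (1 : ℤ))
      (fun _ _ _ => rfl) (fun _ => rfl)
    have := congrArg φ h
    rw [map_pow, map_pow, map_del φ _ _ (m + 1) (fun j hj => hφ j hj),
      prod_map_congr φ _ _ _ (fun j hj => hφ j (hl j hj))] at this
    have e1 : ∀ p, del (fun _ => Multiplicative.ofAdd (1 : ℤ)) p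
        = Multiplicative.ofAdd (p : ℤ) := by
      intro p
      induction p with
      | zero => rfl
      | succ p ih => simp only [del, ih, ← ofAdd_add]; push_cast; rfl
    have e2 : (l.map (fun _ => Multiplicative.ofAdd (1 : ℤ))).prod
        = Multiplicative.ofAdd (l.length : ℤ) := by
      rw [List.map_const', List.prod_replicate, ← ofAdd_nsmul]
      simp
    rw [e1, e2, ← ofAdd_nsmul, ← ofAdd_nsmul] at this
    have h3 := Multiplicative.ofAdd.injective this
    simp only [nsmul_eq_mul] at h3
    have h4 := mul_left_cancel₀ (by positivity) h3
    exact_mod_cast h4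
  have hsp : List.Subperm (List.range (m + 1)) l :=
    List.nodup_range.subperm (fun i hi => hmem i (by simpa using hi))
  exact (hsp.perm_of_length_le (by simp [hlen])).symm

lemma set_eq (m : ℕ) : {β : BraidGroup (m + 2) | IsPositiveBraid (m + 2) β ∧
      β ^ (m + 2) = (halfTwist (m + 2)) ^ 2} =
    (fun t : List.Vector Bool m => cox (gs (m + 2)) t.1) '' Set.univ ∧
    ∀ t : List Bool, t.length = m → IsConj (stdRoot (m + 2)) (cox (gs (m + 2)) t) := by
  obtain ⟨h1, h2⟩ := full_twist (gs (m + 2)) (gs_comm _) (m + 1) (gs_braid (m + 2)) (m + 1) le_rfl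
  have hconj : ∀ t : List Bool, t.length = m →
      IsConj (stdRoot (m + 2)) (cox (gs (m + 2)) t) := by
    intro t ht
    have := cox_conj (gs (m + 2)) t 1 (fun _ _ => Commute.one_left _) (gs_comm _)
    rw [mul_one, mul_one, ht] at this
    rw [stdRoot_eq]
    exact this
  refine ⟨?_, hconj⟩
  rw [halfTwist_eq]
  show {β : BraidGroup (m + 2) | IsPositiveBraid (m + 2) β ∧
      β ^ (m + 2) = (dlt (gs (m + 2)) (m + 1)) ^ 2} = _
  ext β
  simp only [Set.mem_setOf_eq, Set.image_univ, Set.mem_range]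
  constructor
  · rintro ⟨hp, hβ⟩
    obtain ⟨l, hl, rfl⟩ := (positive_iff _ _).1 hp
    rw [h1] at hβ
    obtain ⟨t, ht, he⟩ := root_cox m l hl hβ
    exact ⟨⟨t, ht⟩, he.symm⟩
  · rintro ⟨⟨t, ht⟩, rfl⟩
    constructor
    · obtain ⟨l, hl, he⟩ := cox_word (gs (m + 2)) t
      exact (positive_iff _ _).2 ⟨l, fun j hj => by have := hl j hj; omega, he⟩
    · obtain ⟨l, hl, he⟩ := cox_word (gs (m + 2)) t
      have hc := hconj t ht
      rw [stdRoot_eq, isConj_iff] at hc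
      obtain ⟨c, hc⟩ := hc
      show cox (gs (m + 2)) t ^ (m + 2) = _
      have hall : ∀ c : BraidGroup (m + 2), Commute (dlt (gs (m + 2)) (m + 1) ^ 2) c := by
        intro c
        have : c ∈ Subgroup.centralizer {dlt (gs (m + 2)) (m + 1) ^ 2} := by
          have htop := PresentedGroup.closure_range_of (braidRels (m + 2 - 1))
          have hle : Subgroup.closure (Set.range (PresentedGroup.of (rels := braidRels (m + 2 - 1))))
              ≤ Subgroup.centralizer {dlt (gs (m + 2)) (m + 1) ^ 2} := by
            rw [Subgroup.closure_le]
            rintro _ ⟨j, rfl⟩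
            rw [SetLike.mem_coe, Subgroup.mem_centralizer_singleton_iff, ← gs_of]
            exact (h2 j j.2).eq.symm
          rw [htop] at hle
          exact hle trivial
        rw [Subgroup.mem_centralizer_singleton_iff] at this
        exact this.symm
      rw [← hc, conj_pow]
      show c * del (gs (m + 2)) (m + 1) ^ (m + 2) * c⁻¹ = _
      rw [← h1, ← (hall c).eq]
      group

end BR

/-- For every `n ≥ 2`, the set of positive `n`-th roots of the full twist
`Δ_n²` in `B_n` has exactly `2^(n-2)` elements, and every such root is conjugate in `B_n`
to the standard root `δ_n = σ_1 σ_2 ⋯ σ_{n-1}`. -/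
theorem positive_roots_card_and_conjugate (n : ℕ) (hn : 2 ≤ n) :
    {β : BraidGroup n | IsPositiveBraid n β ∧ β ^ n = (halfTwist n) ^ 2}.ncard = 2 ^ (n - 2) ∧
    ∀ β : BraidGroup n, IsPositiveBraid n β → β ^ n = (halfTwist n) ^ 2 →
      IsConj (stdRoot n) β := by
  obtain ⟨m, rfl⟩ : ∃ m, n = m + 2 := ⟨n - 2, by omega⟩
  obtain ⟨h1, h2⟩ := BR.set_eq m
  constructor
  · rw [h1, Set.ncard_image_of_injective, Set.ncard_univ, Nat.card_eq_fintype_card, card_vector]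
    · simp
    · intro t t' h
      obtain ⟨φ, hφ⟩ := BR.exists_lift (m + 2) BR.sw BR.sw_comm BR.sw_braid
      have h3 := congrArg φ h
      simp only at h3
      rw [BR.map_cox φ _ BR.sw t.1 (fun j hj => hφ j (by have := t.2; omega)),
        BR.map_cox φ _ BR.sw t'.1 (fun j hj => hφ j (by have := t'.2; omega))] at h3
      exact Subtype.ext (BR.cox_sw_inj _ _ (t.2.trans t'.2.symm) h3)
  · intro β hp hβ
    have : β ∈ {β : BraidGroup (m + 2) | IsPositiveBraid (m + 2) β ∧
      β ^ (m + 2) = (halfTwist (m + 2)) ^ 2} := ⟨hp, hβ⟩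
    rw [h1] at this
    obtain ⟨t, -, rfl⟩ := this
    exact h2 t.1 t.2
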